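/- arXiv:cs/0206018 — 5 statements merged into one kernel-verified Lean document; each statement's English description precedes it below -/
import Mathlib

section
/- For every n ≥ 2 and any two permutations σ and τ of Fin n, there exists an injective map f : Fin n → ℝ × ℝ whose values are integer grid points with both coordinates in {1, …, n} (namely f(v) = (position of v in σ, position of v in τ)), such that f is a crossing-free straight-line drawing of both the path P_σ and the path P_τ. In particular, two paths on the same n vertices with a given vertex mapping always admit a simultaneous geometric embedding on an n × n integer grid. -/
/-- A straight-line drawing of a simple graph `G` via the injective map `f` is
crossing-free if the closed segments of any two distinct edges intersect exactly
in the image of the common endpoints of the two edges. -/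
def IsCrossingFreeDrawing {V : Type*} (G : SimpleGraph V) (f : V → ℝ × ℝ) : Prop :=
  Function.Injective f ∧
    ∀ a b c d : V, G.Adj a b → G.Adj c d → s(a, b) ≠ s(c, d) →
      segment ℝ (f a) (f b) ∩ segment ℝ (f c) (f d) = f '' (({a, b} : Set V) ∩ {c, d})

/-- The path on `Fin n` visiting the vertices in the order `σ 0, σ 1, …, σ (n-1)`. -/
def pathGraph {n : ℕ} (σ : Equiv.Perm (Fin n)) : SimpleGraph (Fin n) :=
  SimpleGraph.fromRel fun u v => ∃ i j : Fin n, (i : ℕ) + 1 = (j : ℕ) ∧ u = σ i ∧ v = σ j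

/-- If a linear functional separates the levels of two distinct consecutive edges, listed by
increasing level, then the edges only meet in the image of a common endpoint. -/
lemma segment_inter_subset_of_lt {V : Type*} {f : V → ℝ × ℝ} {φ : ℝ × ℝ →ₗ[ℝ] ℝ} {p : V → ℕ}
    (hp : Function.Injective p) (hφ : ∀ v, φ (f v) = (p v : ℝ) + 1) {a b c d : V}
    (hab : p a + 1 = p b) (hcd : p c + 1 = p d) (hac : p a < p c) :
    segment ℝ (f a) (f b) ∩ segment ℝ (f c) (f d) ⊆ f '' (({a, b} : Set V) ∩ {c, d}) := by
  rintro x ⟨⟨s, t, hs, ht, hst, rfl⟩, s', t', hs', ht', hst', h⟩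
  have hlevel := congrArg φ h
  have hab' : (p a : ℝ) + 1 = p b := by exact_mod_cast hab
  have hcd' : (p c : ℝ) + 1 = p d := by exact_mod_cast hcd
  have hac' : (p a : ℝ) + 1 ≤ p c := by exact_mod_cast hac
  simp only [map_add, map_smul, hφ, smul_eq_mul, ← hab', ← hcd'] at hlevel
  obtain rfl : s = 1 - t := by linarith
  obtain rfl : s' = 1 - t' := by linarith
  have heq : (p c : ℝ) + t' = p a + t := by linarith
  obtain rfl : t = 1 := by linarith
  have hcb : p c = p b := by
    have : (p c : ℝ) = p b := by linarith
    exact_mod_cast this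
  obtain rfl := hp hcb
  exact ⟨c, by simp, by simp⟩

/-- A drawing is crossing-free if some linear functional takes distinct integer values on the
vertices and increases by exactly one along each edge, suitably oriented. -/
lemma isCrossingFreeDrawing_of_levels {V : Type*} {G : SimpleGraph V} {f : V → ℝ × ℝ}
    {φ : ℝ × ℝ →ₗ[ℝ] ℝ} {p : V → ℕ} (hp : Function.Injective p)
    (hφ : ∀ v, φ (f v) = (p v : ℝ) + 1)
    (hG : ∀ a b, G.Adj a b → p a + 1 = p b ∨ p b + 1 = p a) :
    IsCrossingFreeDrawing G f := by
  have hf : Function.Injective f := by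
    intro a b h
    have := congrArg φ h
    rw [hφ, hφ] at this
    exact hp (by exact_mod_cast add_right_cancel this)
  have oriented : ∀ a b c d, p a + 1 = p b → p c + 1 = p d → s(a, b) ≠ s(c, d) →
      segment ℝ (f a) (f b) ∩ segment ℝ (f c) (f d) ⊆ f '' (({a, b} : Set V) ∩ {c, d}) := by
    intro a b c d hab hcd hne
    rcases lt_trichotomy (p a) (p c) with h | h | h
    · exact segment_inter_subset_of_lt hp hφ hab hcd h
    · obtain rfl := hp h
      obtain rfl := hp (hab.symm.trans hcd)
      exact absurd rfl hne
    · rw [Set.inter_comm, Set.inter_comm {a, b}]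
      exact segment_inter_subset_of_lt hp hφ hcd hab h
  refine ⟨hf, fun a b c d hab hcd hne => Set.Subset.antisymm ?_ ?_⟩
  · rcases hG a b hab with h | h <;> rcases hG c d hcd with h' | h'
    · exact oriented a b c d h h' hne
    · rw [segment_symm ℝ (f c), Set.pair_comm c]
      exact oriented a b d c h h' (by rwa [Sym2.eq_swap (a := d)])
    · rw [segment_symm ℝ (f a), Set.pair_comm a]
      exact oriented b a c d h h' (by rwa [Sym2.eq_swap (a := b)])
    · rw [segment_symm ℝ (f a), Set.pair_comm a, segment_symm ℝ (f c), Set.pair_comm c]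
      exact oriented b a d c h h' (by rwa [Sym2.eq_swap (a := b), Sym2.eq_swap (a := d)])
  · have endpoint : ∀ u v w, w ∈ ({u, v} : Set V) → f w ∈ segment ℝ (f u) (f v) := by
      rintro u v w (rfl | rfl)
      · exact left_mem_segment ℝ _ _
      · exact right_mem_segment ℝ _ _
    rintro _ ⟨w, ⟨h, h'⟩, rfl⟩
    exact ⟨endpoint a b w h, endpoint c d w h'⟩

lemma pathGraph_adj_position {n : ℕ} (σ : Equiv.Perm (Fin n)) (a b : Fin n)
    (h : (pathGraph σ).Adj a b) :
    (σ.symm a : ℕ) + 1 = σ.symm b ∨ (σ.symm b : ℕ) + 1 = σ.symm a := by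
  rw [pathGraph, SimpleGraph.fromRel_adj] at h
  rcases h with ⟨-, ⟨i, j, hij, rfl, rfl⟩ | ⟨i, j, hij, rfl, rfl⟩⟩
  · left; simpa using hij
  · right; simpa using hij

/-- Two paths on the same `n` vertices with a given vertex mapping admit a
simultaneous geometric embedding on an `n × n` integer grid, given by placing each
vertex `v` at (position of `v` in `σ`, position of `v` in `τ`). -/
theorem two_paths_simultaneous_embedding (n : ℕ) (hn : 2 ≤ n) (σ τ : Equiv.Perm (Fin n)) :
    ∃ f : Fin n → ℝ × ℝ,
      (∀ v : Fin n, f v = ((((σ.symm v : Fin n) : ℕ) : ℝ) + 1,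
        (((τ.symm v : Fin n) : ℕ) : ℝ) + 1)) ∧
      (∀ v : Fin n, ∃ a b : ℕ, 1 ≤ a ∧ a ≤ n ∧ 1 ≤ b ∧ b ≤ n ∧ f v = ((a : ℝ), (b : ℝ))) ∧
      IsCrossingFreeDrawing (pathGraph σ) f ∧ IsCrossingFreeDrawing (pathGraph τ) f := by
  refine ⟨fun v => (((σ.symm v : ℕ) : ℝ) + 1, ((τ.symm v : ℕ) : ℝ) + 1), fun _ => rfl,
    fun v => ⟨(σ.symm v : ℕ) + 1, (τ.symm v : ℕ) + 1, by omega, by omega, by omega, by omega,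
      by push_cast; rfl⟩, ?_, ?_⟩
  · exact isCrossingFreeDrawing_of_levels (φ := LinearMap.fst ℝ ℝ ℝ)
      (Fin.val_injective.comp σ.symm.injective) (fun _ => rfl) (pathGraph_adj_position σ)
  · exact isCrossingFreeDrawing_of_levels (φ := LinearMap.snd ℝ ℝ ℝ)
      (Fin.val_injective.comp τ.symm.injective) (fun _ => rfl) (pathGraph_adj_position τ)
end

section
/- Let n ≥ 2 and let f : Fin n → ℝ × ℝ be a map whose first coordinates are strictly increasing, i.e., (f i).1 < (f j).1 whenever i < j. Then the polygonal path through f(0), f(1), …, f(n−1) is non-self-intersecting: for all indices i, j ≤ n−2 with i + 1 < j, the closed segments [f i, f (i+1)] and [f j, f (j+1)] are disjoint, and for all i ≤ n−3, the closed segments [f i, f (i+1)] and [f (i+1), f (i+2)] intersect exactly in the single point f (i+1). -/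
theorem fst_mem_Icc_of_mem_segment {p q x : ℝ × ℝ} (hpq : p.1 ≤ q.1)
    (hx : x ∈ segment ℝ p q) : x.1 ∈ Set.Icc p.1 q.1 := by
  rw [← segment_eq_Icc hpq]
  exact (Prod.segment_subset p q hx).1

theorem eq_right_of_mem_segment_of_fst_eq {p q x : ℝ × ℝ} (hpq : p.1 < q.1)
    (hx : x ∈ segment ℝ p q) (h : x.1 = q.1) : x = q := by
  obtain ⟨a, b, -, -, hab, rfl⟩ := hx
  obtain rfl : b = 1 - a := by linarith
  have ha : a * (q.1 - p.1) = 0 := by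
    simp only [Prod.fst_add, Prod.smul_fst, smul_eq_mul] at h
    linarith
  have ha' : a = 0 := (mul_eq_zero.mp ha).resolve_right (sub_pos.mpr hpq).ne'
  simp [ha']

/-- If the first coordinates of `f 0, …, f (n-1)` are strictly increasing, then the
polygonal path through these points is non-self-intersecting: segments of
non-consecutive edges are disjoint, and segments of consecutive edges meet exactly
in their common endpoint. -/
theorem monotone_polygonal_path_non_self_intersecting
    (n : ℕ) (hn : 2 ≤ n) (f : Fin n → ℝ × ℝ)
    (hmono : ∀ i j : Fin n, i < j → (f i).1 < (f j).1) :
    (∀ (i j : ℕ) (hij : i + 1 < j) (hj : j + 1 < n),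
      segment ℝ (f ⟨i, by omega⟩) (f ⟨i + 1, by omega⟩) ∩
        segment ℝ (f ⟨j, by omega⟩) (f ⟨j + 1, by omega⟩) = ∅) ∧
    (∀ (i : ℕ) (hi : i + 2 < n),
      segment ℝ (f ⟨i, by omega⟩) (f ⟨i + 1, by omega⟩) ∩
        segment ℝ (f ⟨i + 1, by omega⟩) (f ⟨i + 2, by omega⟩) = {f ⟨i + 1, by omega⟩}) := by
  constructor
  · intro i j hij hj
    refine Set.eq_empty_of_forall_notMem fun x ⟨hx, hy⟩ => ?_
    have h₁ := fst_mem_Icc_of_mem_segment (hmono _ _ (Fin.mk_lt_mk.mpr (Nat.lt_succ_self i))).le hx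
    have h₂ := fst_mem_Icc_of_mem_segment (hmono _ _ (Fin.mk_lt_mk.mpr (Nat.lt_succ_self j))).le hy
    have h₃ := hmono ⟨i + 1, by omega⟩ ⟨j, by omega⟩ (Fin.mk_lt_mk.mpr hij)
    exact absurd (h₂.1.trans h₁.2) h₃.not_ge
  · intro i hi
    have h₁ := hmono ⟨i, by omega⟩ ⟨i + 1, by omega⟩ (Fin.mk_lt_mk.mpr (by omega))
    have h₂ := hmono ⟨i + 1, by omega⟩ ⟨i + 2, by omega⟩ (Fin.mk_lt_mk.mpr (by omega))
    refine Set.Subset.antisymm (fun x ⟨hx, hy⟩ => ?_) ?_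
    · exact eq_right_of_mem_segment_of_fst_eq h₁ hx
        (le_antisymm (fst_mem_Icc_of_mem_segment h₁.le hx).2
          (fst_mem_Icc_of_mem_segment h₂.le hy).1)
    · exact Set.singleton_subset_iff.mpr
        ⟨right_mem_segment ℝ _ _, left_mem_segment ℝ _ _⟩
end

section
/- There exist five permutations of Fin 5, namely the five vertex orderings (v₁,v₂,v₃,v₄,v₅), (v₁,v₃,v₅,v₄,v₂), (v₂,v₅,v₁,v₃,v₄), (v₃,v₂,v₄,v₁,v₅), (v₃,v₅,v₂,v₁,v₄) of the vertices v₁,…,v₅, such that for every injective map f : Fin 5 → ℝ², at least one of the five corresponding paths fails to be drawn crossing-free under f; that is, some one of the five paths has two vertex-disjoint edges {a,b} and {c,d} for which the closed segments [f a, f b] and [f c, f d] intersect. Hence these five paths on the same vertex set admit no simultaneous geometric embedding. -/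
/-- The vertex ordering `(v₁, v₂, v₃, v₄, v₅)` (0-indexed). -/
noncomputable def perm1 : Equiv.Perm (Fin 5) := Equiv.ofBijective ![0, 1, 2, 3, 4] (by decide)
/-- The vertex ordering `(v₁, v₃, v₅, v₄, v₂)`. -/
noncomputable def perm2 : Equiv.Perm (Fin 5) := Equiv.ofBijective ![0, 2, 4, 3, 1] (by decide)
/-- The vertex ordering `(v₂, v₅, v₁, v₃, v₄)`. -/
noncomputable def perm3 : Equiv.Perm (Fin 5) := Equiv.ofBijective ![1, 4, 0, 2, 3] (by decide)
/-- The vertex ordering `(v₃, v₂, v₄, v₁, v₅)`. -/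
noncomputable def perm4 : Equiv.Perm (Fin 5) := Equiv.ofBijective ![2, 1, 3, 0, 4] (by decide)
/-- The vertex ordering `(v₃, v₅, v₂, v₁, v₄)`. -/
noncomputable def perm5 : Equiv.Perm (Fin 5) := Equiv.ofBijective ![2, 4, 1, 0, 3] (by decide)

/-- If at most two entries of a real vector indexed by `Fin 5` are positive and at most two are
negative, then the supports of its positive and negative parts lie in disjoint pairs. -/
lemma exists_disjoint_pairs_of_card_le_two {w : Fin 5 → ℝ}
    (hpos : (Finset.univ.filter fun i => 0 < w i).card ≤ 2)
    (hneg : (Finset.univ.filter fun i => w i < 0).card ≤ 2) :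
    ∃ a b c d : Fin 5, a ≠ b ∧ c ≠ d ∧ a ≠ c ∧ a ≠ d ∧ b ≠ c ∧ b ≠ d ∧
      0 ≤ w a ∧ 0 ≤ w b ∧ w c ≤ 0 ∧ w d ≤ 0 ∧
      ∀ e, e ≠ a → e ≠ b → e ≠ c → e ≠ d → w e = 0 := by
  set P := Finset.univ.filter fun i => 0 < w i with hP
  set N := Finset.univ.filter fun i => w i < 0 with hN
  have hPN : P ⊆ Nᶜ := fun i hi => by
    simp only [hP, hN, Finset.mem_filter, Finset.mem_univ, true_and, Finset.mem_compl, not_lt]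
      at hi ⊢
    exact hi.le
  have hNc : 2 ≤ Nᶜ.card := by
    rw [Finset.card_compl, Fintype.card_fin]; omega
  obtain ⟨A, hPA, hAN, hA⟩ := Finset.exists_subsuperset_card_eq hPN hpos hNc
  have hNA : N ⊆ Aᶜ := by rwa [Finset.subset_compl_comm]
  have hAc : 2 ≤ Aᶜ.card := by
    rw [Finset.card_compl, Fintype.card_fin]; omega
  obtain ⟨B, hNB, hBA, hB⟩ := Finset.exists_subsuperset_card_eq hNA hneg hAc
  obtain ⟨a, b, hab, rfl⟩ := Finset.card_eq_two.1 hA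
  obtain ⟨c, d, hcd, rfl⟩ := Finset.card_eq_two.1 hB
  have nonneg : ∀ i ∈ ({a, b} : Finset (Fin 5)), 0 ≤ w i := fun i hi => by
    simpa [hN] using hAN hi
  have nonpos : ∀ i ∉ ({a, b} : Finset (Fin 5)), w i ≤ 0 := fun i hi => by
    simpa [hP] using fun h => hi (hPA h)
  have nonneg' : ∀ i ∉ ({c, d} : Finset (Fin 5)), 0 ≤ w i := fun i hi => by
    simpa [hN] using fun h => hi (hNB h)
  have hc := hBA (Finset.mem_insert_self c {d})
  have hd := hBA (show d ∈ ({c, d} : Finset (Fin 5)) by simp)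
  rw [Finset.mem_compl] at hc hd
  refine ⟨a, b, c, d, hab, hcd, ?_, ?_, ?_, ?_, nonneg a (by simp), nonneg b (by simp),
    nonpos c hc, nonpos d hd, fun e _ _ _ _ =>
      le_antisymm (nonpos e (by simp [*])) (nonneg' e (by simp [*]))⟩
  all_goals rintro rfl; simp at hc hd

/-- A real vector space of `Fin 5`-indexed vectors of dimension at least two contains a nonzero
vector with at most two positive and at most two negative entries. -/
lemma Submodule.exists_ne_zero_card_pos_le_two_card_neg_le_two (K : Submodule ℝ (Fin 5 → ℝ))
    (hK : 1 < Module.finrank ℝ K) :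
    ∃ w ∈ K, w ≠ 0 ∧ (Finset.univ.filter fun i => 0 < w i).card ≤ 2 ∧
      (Finset.univ.filter fun i => w i < 0).card ≤ 2 := by
  by_contra! H
  let U : Set K := ⋃ s ∈ Finset.powersetCard 3 (Finset.univ : Finset (Fin 5)),
    ⋂ i ∈ s, {w : K | 0 < w.1 i}
  let V : Set K := ⋃ s ∈ Finset.powersetCard 3 (Finset.univ : Finset (Fin 5)),
    ⋂ i ∈ s, {w : K | w.1 i < 0}
  have hcont (i : Fin 5) : Continuous fun w : K => w.1 i :=
    (continuous_apply i).comp continuous_subtype_val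
  have hU : IsOpen U := isOpen_biUnion fun s _ => isOpen_biInter_finset fun i _ =>
    isOpen_lt continuous_const (hcont i)
  have hV : IsOpen V := isOpen_biUnion fun s _ => isOpen_biInter_finset fun i _ =>
    isOpen_lt (hcont i) continuous_const
  have memU {w : K} : w ∈ U ↔ ∃ s : Finset (Fin 5), s.card = 3 ∧ ∀ i ∈ s, 0 < w.1 i := by
    simp [U]
  have memV {w : K} : w ∈ V ↔ ∃ s : Finset (Fin 5), s.card = 3 ∧ ∀ i ∈ s, w.1 i < 0 := by
    simp [V]
  have hneg {w : K} : -w ∈ V ↔ w ∈ U := by simp [memU, memV]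
  have hcover : ({0}ᶜ : Set K) ⊆ U ∪ V := by
    intro w hw
    by_cases hp : (Finset.univ.filter fun i => 0 < w.1 i).card ≤ 2
    · obtain ⟨s, hs, hs3⟩ := Finset.exists_subset_card_eq
        (H w.1 w.2 (by simpa using hw) hp)
      exact .inr (memV.2 ⟨s, hs3, fun i hi => by simpa using hs hi⟩)
    · obtain ⟨s, hs, hs3⟩ := Finset.exists_subset_card_eq (not_le.1 hp)
      exact .inl (memU.2 ⟨s, hs3, fun i hi => by simpa using hs hi⟩)
  have hrank : 1 < Module.rank ℝ K := Module.lt_rank_of_lt_finrank (by exact_mod_cast hK)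
  have hconn := isConnected_compl_singleton_of_one_lt_rank hrank (0 : K)
  obtain ⟨w, hw⟩ := hconn.nonempty
  have hw' : -w ∈ ({0}ᶜ : Set K) := by simpa using hw
  have hUV : (({0}ᶜ : Set K) ∩ U).Nonempty ∧ (({0}ᶜ : Set K) ∩ V).Nonempty := by
    rcases hcover hw with h | h
    · exact ⟨⟨w, hw, h⟩, ⟨-w, hw', hneg.2 h⟩⟩
    · exact ⟨⟨-w, hw', hneg.1 (by rwa [neg_neg])⟩, ⟨w, hw, h⟩⟩
  obtain ⟨v, -, hvU, hvV⟩ := hconn.isPreconnected U V hU hV hcover hUV.1 hUV.2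
  obtain ⟨s, hs, hs'⟩ := memU.1 hvU
  obtain ⟨t, ht, ht'⟩ := memV.1 hvV
  have hdisj : Disjoint s t :=
    Finset.disjoint_left.2 fun i hi hi' => (hs' i hi).not_gt (ht' i hi')
  have := Finset.card_le_univ (s ∪ t)
  rw [Finset.card_union_of_disjoint hdisj, hs, ht, Fintype.card_fin] at this
  omega

/-- Every straight-line drawing of `K₅` has two vertex-disjoint edges that intersect. -/
lemma exists_disjoint_pairs_segment_inter_nonempty (f : Fin 5 → ℝ × ℝ) :
    ∃ a b c d : Fin 5, a ≠ b ∧ c ≠ d ∧ a ≠ c ∧ a ≠ d ∧ b ≠ c ∧ b ≠ d ∧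
      (segment ℝ (f a) (f b) ∩ segment ℝ (f c) (f d)).Nonempty := by
  let T : (Fin 5 → ℝ) →ₗ[ℝ] ℝ × (ℝ × ℝ) :=
    (Fintype.linearCombination ℝ fun _ => (1 : ℝ)).prod (Fintype.linearCombination ℝ f)
  have hK : 1 < Module.finrank ℝ (LinearMap.ker T) := by
    have h1 := T.finrank_range_add_finrank_ker
    have h2 := Submodule.finrank_le (LinearMap.range T)
    simp only [Module.finrank_prod, Module.finrank_self, Module.finrank_fin_fun] at h1 h2
    omega
  obtain ⟨w, hwK, hw0, hpos, hneg⟩ :=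
    (LinearMap.ker T).exists_ne_zero_card_pos_le_two_card_neg_le_two hK
  obtain ⟨a, b, c, d, hab, hcd, hac, had, hbc, hbd, ha, hb, hc, hd, hzero⟩ :=
    exists_disjoint_pairs_of_card_le_two hpos hneg
  have hsum {E : Type} [AddCommGroup E] [Module ℝ E] (g : Fin 5 → E) :
      ∑ i, w i • g i = w a • g a + w b • g b + (w c • g c + w d • g d) := by
    rw [← Finset.sum_subset (Finset.subset_univ ({a, b, c, d} : Finset (Fin 5)))]
    · rw [Finset.sum_insert (by simp [*]), Finset.sum_insert (by simp [*]),
        Finset.sum_pair hcd]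
      abel
    · intro e _ he
      simp only [Finset.mem_insert, Finset.mem_singleton, not_or] at he
      rw [hzero e he.1 he.2.1 he.2.2.1 he.2.2.2, zero_smul]
  have hT : ∑ i, w i • (1 : ℝ) = 0 ∧ ∑ i, w i • f i = 0 := by
    simpa [T, Fintype.linearCombination_apply, Prod.ext_iff] using hwK
  rw [hsum, hsum] at hT
  obtain ⟨h1, hf⟩ := hT
  simp only [smul_eq_mul, mul_one] at h1
  have hS : 0 < w a + w b := by
    by_contra! h
    refine hw0 (funext fun e => ?_)
    rw [Pi.zero_apply]
    by_cases hea : e = a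
    · subst hea; linarith
    by_cases heb : e = b
    · subst heb; linarith
    by_cases hec : e = c
    · subst hec; linarith
    by_cases hed : e = d
    · subst hed; linarith
    exact hzero e hea heb hec hed
  refine ⟨a, b, c, d, hab, hcd, hac, had, hbc, hbd,
    (w a / (w a + w b)) • f a + (w b / (w a + w b)) • f b,
    ⟨_, _, div_nonneg ha hS.le, div_nonneg hb hS.le, by field_simp, rfl⟩,
    -w c / (w a + w b), -w d / (w a + w b), div_nonneg (by linarith) hS.le,
    div_nonneg (by linarith) hS.le, ?_, ?_⟩
  · field_simp; linarith
  · rw [← sub_eq_zero, ← smul_zero (-(w a + w b)⁻¹), ← hf]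
    simp only [div_eq_inv_mul]
    module

lemma pathGraph_adj_of_succ {n : ℕ} (σ : Equiv.Perm (Fin n)) {i j : Fin n}
    (h : (i : ℕ) + 1 = j) : (pathGraph σ).Adj (σ i) (σ j) := by
  rw [pathGraph, SimpleGraph.fromRel_adj]
  exact ⟨σ.injective.ne (by rintro rfl; omega), .inl ⟨i, j, h, rfl, rfl⟩⟩

/-- Two vertices at consecutive positions of the sequence `p`. -/
abbrev ConsecutiveIn (p : Fin 5 → Fin 5) (a b : Fin 5) : Prop :=
  ∃ i : Fin 4, p i.castSucc = a ∧ p i.succ = b ∨ p i.castSucc = b ∧ p i.succ = a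

lemma ConsecutiveIn.adj {σ : Equiv.Perm (Fin 5)} {a b : Fin 5} (h : ConsecutiveIn σ a b) :
    (pathGraph σ).Adj a b := by
  obtain ⟨i, ⟨rfl, rfl⟩ | ⟨rfl, rfl⟩⟩ := h
  · exact pathGraph_adj_of_succ σ (by simp)
  · exact (pathGraph_adj_of_succ σ (by simp)).symm

/-- Each pair of disjoint edges of `K₅` occurs in one of the five paths. -/
lemma exists_consecutiveIn_of_disjoint : ∀ a b c d : Fin 5,
    a ≠ b → c ≠ d → a ≠ c → a ≠ d → b ≠ c → b ≠ d →
      ∃ p ∈ [![0, 1, 2, 3, 4], ![0, 2, 4, 3, 1], ![1, 4, 0, 2, 3], ![2, 1, 3, 0, 4],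
        ![2, 4, 1, 0, 3]], ConsecutiveIn p a b ∧ ConsecutiveIn p c d := by
  decide +kernel

/-- For every injective `f : Fin 5 → ℝ²`, at least one of the five paths
`P_{perm1}, …, P_{perm5}` has two vertex-disjoint edges whose closed segments
intersect under `f`; hence these five paths on the same vertex set admit no
simultaneous geometric embedding. -/
theorem five_paths_not_simultaneously_embeddable :
    ∀ f : Fin 5 → ℝ × ℝ, Function.Injective f →
      ∃ σ ∈ ({perm1, perm2, perm3, perm4, perm5} : Set (Equiv.Perm (Fin 5))),
        ∃ a b c d : Fin 5, (pathGraph σ).Adj a b ∧ (pathGraph σ).Adj c d ∧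
          a ≠ c ∧ a ≠ d ∧ b ≠ c ∧ b ≠ d ∧
          (segment ℝ (f a) (f b) ∩ segment ℝ (f c) (f d)).Nonempty := by
  intro f _
  obtain ⟨a, b, c, d, hab, hcd, hac, had, hbc, hbd, hne⟩ :=
    exists_disjoint_pairs_segment_inter_nonempty f
  obtain ⟨p, hp, h₁, h₂⟩ := exists_consecutiveIn_of_disjoint a b c d hab hcd hac had hbc hbd
  obtain ⟨σ, hσ, rfl⟩ : ∃ σ ∈ ({perm1, perm2, perm3, perm4, perm5} :
      Set (Equiv.Perm (Fin 5))), ⇑σ = p := by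
    simp only [List.mem_cons, List.not_mem_nil, or_false] at hp
    rcases hp with rfl | rfl | rfl | rfl | rfl
    exacts [⟨perm1, by simp, rfl⟩, ⟨perm2, by simp, rfl⟩, ⟨perm3, by simp, rfl⟩,
      ⟨perm4, by simp, rfl⟩, ⟨perm5, by simp, rfl⟩]
  exact ⟨σ, hσ, a, b, c, d, h₁.adj, h₂.adj, hac, had, hbc, hbd, hne⟩
end

section
/- For every injective map f : Fin 5 → ℝ², there exist four pairwise distinct vertices a, b, c, d ∈ Fin 5 such that the closed segments [f a, f b] and [f c, f d] have nonempty intersection. (Equivalently: in every straight-line drawing of the complete graph K₅ in the plane, some two edges with no common endpoint cross.) -/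
/-- Twice the signed area of the triangle with vertices `p`, `q`, `r`. -/
def signedArea (p q r : ℝ × ℝ) : ℝ :=
  (q.1 - p.1) * (r.2 - p.2) - (q.2 - p.2) * (r.1 - p.1)

/-- Among the six segments spanned by four points, some two opposite ones meet. -/
def HasCrossing (p q r s : ℝ × ℝ) : Prop :=
  (segment ℝ p q ∩ segment ℝ r s).Nonempty ∨ (segment ℝ p r ∩ segment ℝ q s).Nonempty ∨
    (segment ℝ p s ∩ segment ℝ q r).Nonempty

lemma HasCrossing.swap_right {p q r s : ℝ × ℝ} (h : HasCrossing p q r s) :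
    HasCrossing p q s r := by
  unfold HasCrossing at *
  rw [segment_symm ℝ s r, segment_symm ℝ q s, segment_symm ℝ q r] at *
  tauto

lemma HasCrossing.rotate {p q r s : ℝ × ℝ} (h : HasCrossing p q r s) :
    HasCrossing s p q r := by
  unfold HasCrossing at *
  rw [segment_symm ℝ s p, segment_symm ℝ s q, segment_symm ℝ s r,
    Set.inter_comm (segment ℝ q s), Set.inter_comm (segment ℝ r s)]
  tauto

/-- An affine dependence between four points in which `p`, `q` have weights of the same sign and
`r`, `s` have weights of the same sign yields a common point of `[p, q]` and `[r, s]`. -/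
lemma segment_inter_nonempty_of_affine_dependence {E : Type*} [AddCommGroup E] [Module ℝ E]
    {p q r s : E} {α β γ δ : ℝ} (hαβ : 0 < α * β) (hγδ : 0 < γ * δ)
    (hsum : α + β + γ + δ = 0) (hdep : α • p + β • q + γ • r + δ • s = 0) :
    (segment ℝ p q ∩ segment ℝ r s).Nonempty := by
  have key : ∀ {x y : ℝ}, 0 < x * y → x + y ≠ 0 ∧ 0 ≤ x / (x + y) ∧ 0 ≤ y / (x + y) := by
    intro x y hxy
    have hne : x + y ≠ 0 := fun h ↦ by
      rw [eq_neg_of_add_eq_zero_right h] at hxy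
      nlinarith [sq_nonneg x]
    refine ⟨hne, ?_, ?_⟩ <;>
    · rw [← mul_div_mul_right _ _ hne]
      refine div_nonneg ?_ (mul_self_nonneg _)
      nlinarith [sq_nonneg x, sq_nonneg y]
  obtain ⟨h₁, hα, hβ⟩ := key hαβ
  obtain ⟨h₂, hγ, hδ⟩ := key hγδ
  refine ⟨(α / (α + β)) • p + (β / (α + β)) • q,
    ⟨_, _, hα, hβ, by rw [← add_div, div_self h₁], rfl⟩,
    ⟨_, _, hγ, hδ, by rw [← add_div, div_self h₂], ?_⟩⟩
  have h₃ : γ + δ = -(α + β) := by linarith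
  have h₄ : γ • r + δ • s = -(α • p + β • q) := by
    rw [eq_neg_iff_add_eq_zero, ← hdep]; abel
  simp only [div_eq_inv_mul, mul_smul, ← smul_add]
  rw [h₄, h₃, inv_neg, neg_smul_neg]

lemma collinear_of_signedArea_eq_zero {p q r : ℝ × ℝ} (h : signedArea p q r = 0) :
    Collinear ℝ {p, q, r} := by
  by_cases hpq : p = q
  · subst hpq
    simpa using collinear_pair ℝ p r
  rw [collinear_iff_of_mem (p₀ := p) (by simp)]
  have hne : (q.1 - p.1) ^ 2 + (q.2 - p.2) ^ 2 ≠ 0 := by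
    intro h0
    apply hpq
    ext <;> nlinarith [sq_nonneg (q.1 - p.1), sq_nonneg (q.2 - p.2)]
  refine ⟨q - p, ?_⟩
  simp only [Set.mem_insert_iff, Set.mem_singleton_iff, forall_eq_or_imp, forall_eq]
  refine ⟨⟨0, by simp⟩, ⟨1, by simp⟩,
    ⟨((r.1 - p.1) * (q.1 - p.1) + (r.2 - p.2) * (q.2 - p.2)) /
      ((q.1 - p.1) ^ 2 + (q.2 - p.2) ^ 2), ?_⟩⟩
  unfold signedArea at h
  ext
  · simp only [vadd_eq_add, Prod.fst_add, Prod.smul_fst, Prod.fst_sub, smul_eq_mul]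
    field_simp
    linear_combination -(q.2 - p.2) * h
  · simp only [vadd_eq_add, Prod.snd_add, Prod.smul_snd, Prod.snd_sub, smul_eq_mul]
    field_simp
    linear_combination (q.1 - p.1) * h

/-- If three of four points are collinear, two opposite edges of the quadruple meet. -/
lemma hasCrossing_of_signedArea_eq_zero {p q r : ℝ × ℝ} (s : ℝ × ℝ)
    (h : signedArea p q r = 0) : HasCrossing p q r s := by
  rcases (collinear_of_signedArea_eq_zero h).wbtw_or_wbtw_or_wbtw with h | h | h <;>
    rw [← mem_segment_iff_wbtw] at h
  · exact .inr (.inl ⟨q, h, left_mem_segment ℝ q s⟩)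
  · exact .inl ⟨r, segment_symm ℝ q p ▸ h, left_mem_segment ℝ r s⟩
  · exact .inr (.inr ⟨p, left_mem_segment ℝ p s, segment_symm ℝ r q ▸ h⟩)

/-- Four points whose signed areas have nonnegative product have two opposite edges that meet. -/
lemma hasCrossing_of_prod_signedArea_nonneg {p q r s : ℝ × ℝ}
    (h : 0 ≤ signedArea q r s * signedArea p r s * signedArea p q s * signedArea p q r) :
    HasCrossing p q r s := by
  by_cases h₁ : signedArea p q r = 0
  · exact hasCrossing_of_signedArea_eq_zero s h₁
  by_cases h₂ : signedArea p q s = 0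
  · exact (hasCrossing_of_signedArea_eq_zero r h₂).swap_right
  by_cases h₃ : signedArea p r s = 0
  · exact (hasCrossing_of_signedArea_eq_zero q h₃).swap_right.rotate.swap_right.rotate.rotate.rotate
  by_cases h₄ : signedArea q r s = 0
  · exact (hasCrossing_of_signedArea_eq_zero p h₄).rotate
  have hsum : signedArea q r s + -signedArea p r s + signedArea p q s + -signedArea p q r = 0 := by
    unfold signedArea; ring
  have hdep : signedArea q r s • p + -signedArea p r s • q + signedArea p q s • r +
      -signedArea p q r • s = 0 := by
    ext <;> simp [signedArea] <;> ring
  have hprod : 0 < signedArea q r s * -signedArea p r s * signedArea p q s *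
      -signedArea p q r := by
    refine lt_of_le_of_ne (by linarith) (Ne.symm ?_)
    simp [h₁, h₂, h₃, h₄]
  generalize signedArea q r s = α, -signedArea p r s = β, signedArea p q s = γ,
    -signedArea p q r = δ at hsum hdep hprod
  rcases lt_or_ge 0 (α * β) with hαβ | hαβ
  · refine .inl (segment_inter_nonempty_of_affine_dependence hαβ ?_ hsum hdep)
    exact pos_of_mul_pos_right (by linarith : 0 < (α * β) * (γ * δ)) hαβ.le
  rcases lt_or_ge 0 (α * γ) with hαγ | hαγ
  · refine .inr (.inl (segment_inter_nonempty_of_affine_dependence (γ := β) (δ := δ) hαγ ?_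
      (by linarith) (by rw [← hdep]; abel)))
    exact pos_of_mul_pos_right (by linarith : 0 < (α * γ) * (β * δ)) hαγ.le
  have hβγ : 0 < β * γ := by
    have hα : α ≠ 0 := by rintro rfl; simp at hprod
    have hβ : β ≠ 0 := by rintro rfl; simp at hprod
    have hγ : γ ≠ 0 := by rintro rfl; simp at hprod
    have := mul_pos_of_neg_of_neg (hαβ.lt_of_ne (mul_ne_zero hα hβ))
      (hαγ.lt_of_ne (mul_ne_zero hα hγ))
    exact pos_of_mul_pos_right (by linarith : 0 < α ^ 2 * (β * γ)) (sq_nonneg α)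
  refine .inr (.inr (segment_inter_nonempty_of_affine_dependence (α := α) (β := δ)
      ?_ hβγ (by linarith) (by rw [← hdep]; abel)))
  exact pos_of_mul_pos_right (by linarith : 0 < (β * γ) * (α * δ)) hβγ.le

/-- In every straight-line drawing of `K₅` in the plane (i.e. for every injective
placement of five points), some two edges with no common endpoint cross: there are
four pairwise distinct vertices `a, b, c, d` whose segments `[f a, f b]` and
`[f c, f d]` have nonempty intersection. -/
theorem K5_has_crossing (f : Fin 5 → ℝ × ℝ) (hf : Function.Injective f) :
    ∃ a b c d : Fin 5, a ≠ b ∧ a ≠ c ∧ a ≠ d ∧ b ≠ c ∧ b ≠ d ∧ c ≠ d ∧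
      (segment ℝ (f a) (f b) ∩ segment ℝ (f c) (f d)).Nonempty := by
  have cross : ∀ {a b c d : Fin 5}, a ≠ b → a ≠ c → a ≠ d → b ≠ c → b ≠ d → c ≠ d →
      HasCrossing (f a) (f b) (f c) (f d) →
      ∃ a b c d : Fin 5, a ≠ b ∧ a ≠ c ∧ a ≠ d ∧ b ≠ c ∧ b ≠ d ∧ c ≠ d ∧
        (segment ℝ (f a) (f b) ∩ segment ℝ (f c) (f d)).Nonempty := by
    rintro a b c d hab hac had hbc hbd hcd (h | h | h)
    · exact ⟨a, b, c, d, hab, hac, had, hbc, hbd, hcd, h⟩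
    · exact ⟨a, c, b, d, hac, hab, had, hbc.symm, hcd, hbd, h⟩
    · exact ⟨a, d, b, c, had, hab, hac, hbd.symm, hcd.symm, hbc, h⟩
  by_contra hno
  have neg : ∀ {a b c d : Fin 5}, a ≠ b → a ≠ c → a ≠ d → b ≠ c → b ≠ d → c ≠ d →
      signedArea (f b) (f c) (f d) * signedArea (f a) (f c) (f d) *
        signedArea (f a) (f b) (f d) * signedArea (f a) (f b) (f c) < 0 :=
    fun hab hac had hbc hbd hcd ↦ lt_of_not_ge fun h ↦
      hno (cross hab hac had hbc hbd hcd (hasCrossing_of_prod_signedArea_nonneg h))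
  have h₀ := @neg 1 2 3 4 (by decide) (by decide) (by decide) (by decide) (by decide) (by decide)
  have h₁ := @neg 0 2 3 4 (by decide) (by decide) (by decide) (by decide) (by decide) (by decide)
  have h₂ := @neg 0 1 3 4 (by decide) (by decide) (by decide) (by decide) (by decide) (by decide)
  have h₃ := @neg 0 1 2 4 (by decide) (by decide) (by decide) (by decide) (by decide) (by decide)
  have h₄ := @neg 0 1 2 3 (by decide) (by decide) (by decide) (by decide) (by decide) (by decide)
  -- Each of the ten triples lies in two quadruples, so the product of all five is a square.
  have hlt := mul_neg_of_pos_of_neg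
    (mul_pos (mul_pos_of_neg_of_neg h₀ h₁) (mul_pos_of_neg_of_neg h₂ h₃)) h₄
  refine hlt.not_ge ((sq_nonneg (
    signedArea (f 0) (f 1) (f 2) * signedArea (f 0) (f 1) (f 3) * signedArea (f 0) (f 1) (f 4) *
    signedArea (f 0) (f 2) (f 3) * signedArea (f 0) (f 2) (f 4) * signedArea (f 0) (f 3) (f 4) *
    signedArea (f 1) (f 2) (f 3) * signedArea (f 1) (f 2) (f 4) * signedArea (f 1) (f 3) (f 4) *
    signedArea (f 2) (f 3) (f 4))).trans_eq ?_)
  ring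
end

section
/- For any permutation σ of Fin 5, the number of unordered pairs {{a,b}, {c,d}} of vertex-disjoint edges (a, b, c, d pairwise distinct) such that both {a,b} and {c,d} are edges of the path P_σ is at most 3. (Thus each Hamiltonian path on five vertices 'eliminates' at most three of the fifteen vertex-disjoint edge pairings of K₅.) -/
theorem pathGraph_adj_iff {n : ℕ} (σ : Equiv.Perm (Fin (n + 1))) (u v : Fin (n + 1)) :
    (pathGraph σ).Adj u v ↔ ∃ k : Fin n, s(u, v) = s(σ k.castSucc, σ k.succ) := by
  have key (i j : Fin (n + 1)) :
      (i : ℕ) + 1 = j ↔ ∃ k : Fin n, i = k.castSucc ∧ j = k.succ := by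
    refine ⟨fun h => ⟨⟨i, by omega⟩, rfl, Fin.ext h.symm⟩, ?_⟩
    rintro ⟨k, rfl, rfl⟩
    simp
  simp only [pathGraph, SimpleGraph.fromRel_adj, key, Sym2.eq_iff]
  constructor
  · rintro ⟨-, ⟨_, _, ⟨k, rfl, rfl⟩, rfl, rfl⟩ | ⟨_, _, ⟨k, rfl, rfl⟩, rfl, rfl⟩⟩
    exacts [⟨k, .inl ⟨rfl, rfl⟩⟩, ⟨k, .inr ⟨rfl, rfl⟩⟩]
  · rintro ⟨k, ⟨rfl, rfl⟩ | ⟨rfl, rfl⟩⟩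
    · exact ⟨fun h => k.castSucc_lt_succ.ne (σ.injective h),
        .inl ⟨_, _, ⟨k, rfl, rfl⟩, rfl, rfl⟩⟩
    · exact ⟨fun h => k.castSucc_lt_succ.ne' (σ.injective h),
        .inr ⟨_, _, ⟨k, rfl, rfl⟩, rfl, rfl⟩⟩

/-- Each Hamiltonian path on five vertices contains at most three of the fifteen
vertex-disjoint edge pairings of `K₅`: the number of unordered pairs
`{{a,b}, {c,d}}` of vertex-disjoint edges both of which are edges of `P_σ` is at
most `3`. -/
theorem path_eliminates_at_most_three_pairings (σ : Equiv.Perm (Fin 5)) :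
    {P : Sym2 (Sym2 (Fin 5)) | ∃ a b c d : Fin 5,
        P = s(s(a, b), s(c, d)) ∧
        a ≠ b ∧ a ≠ c ∧ a ≠ d ∧ b ≠ c ∧ b ≠ d ∧ c ≠ d ∧
        (pathGraph σ).Adj a b ∧ (pathGraph σ).Adj c d}.ncard ≤ 3 := by
  let e (k : Fin 4) : Sym2 (Fin 5) := s(σ k.castSucc, σ k.succ)
  refine (Set.ncard_le_ncard (t := ↑({s(e 0, e 2), s(e 0, e 3), s(e 1, e 3)} :
    Finset (Sym2 (Sym2 (Fin 5))))) ?_ (Finset.finite_toSet _)).trans ?_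
  · rintro _ ⟨a, b, c, d, rfl, -, hac, had, hbc, hbd, -, hab, hcd⟩
    obtain ⟨k, hk⟩ := (pathGraph_adj_iff σ a b).1 hab
    obtain ⟨l, hl⟩ := (pathGraph_adj_iff σ c d).1 hcd
    have disj : ∀ x ∈ s(a, b), x ∉ s(c, d) := by
      simp [hac, had, hbc, hbd]
    rw [hk, hl] at disj ⊢
    have hkl : k.castSucc ≠ l.castSucc ∧ k.castSucc ≠ l.succ ∧ k.succ ≠ l.castSucc := by
      refine ⟨fun h => ?_, fun h => ?_, fun h => ?_⟩
      · exact disj _ (Sym2.mem_mk_left _ _) (h ▸ Sym2.mem_mk_left _ _)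
      · exact disj _ (Sym2.mem_mk_left _ _) (h ▸ Sym2.mem_mk_right _ _)
      · exact disj _ (Sym2.mem_mk_right _ _) (h ▸ Sym2.mem_mk_left _ _)
    have cases : (k = 0 ∧ l = 2 ∨ k = 0 ∧ l = 3 ∨ k = 1 ∧ l = 3) ∨
        (l = 0 ∧ k = 2 ∨ l = 0 ∧ k = 3 ∨ l = 1 ∧ k = 3) := by
      clear disj hk hl
      decide +revert
    change s(e k, e l) ∈ _
    rcases cases with h | h
    · rcases h with ⟨rfl, rfl⟩ | ⟨rfl, rfl⟩ | ⟨rfl, rfl⟩ <;> simp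
    · rw [Sym2.eq_swap]
      rcases h with ⟨rfl, rfl⟩ | ⟨rfl, rfl⟩ | ⟨rfl, rfl⟩ <;> simp
  · rw [Set.ncard_coe_finset]
    exact Finset.card_le_three
end
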